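/- Let T² ∈ ℝ with T² ≠ 0, and consider on ℝ² the connection with constant Christoffel symbols Γ_{11}¹ = 1, Γ_{12}² = 1 + T², Γ_{21}² = 1 − T², and all other Γ_{ij}^k = 0 (the model M₁⁶(0,T²)). Then a smooth vector field X on ℝ² is an affine Killing vector field for this connection if and only if X lies in the ℝ-linear span of the four vector fields (1,0), (0,1), (0, x²), and (0, e^{−x¹}). -/

import Mathlib

open Real

/-- The partial derivative `∂f/∂x^i` of a function on `ℝ²` (points are `Fin 2 → ℝ`). -/
noncomputable def pd (f : (Fin 2 → ℝ) → ℝ) (i : Fin 2) (p : Fin 2 → ℝ) : ℝ :=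
  fderiv ℝ f p (Pi.single i 1)

/-- The affine Killing operator
`K^Γ_{ij}^k(v) = ∂_i∂_j v^k + v^l ∂_l Γ_{ij}^k − Γ_{ij}^l ∂_l v^k + Γ_{il}^k ∂_j v^l + Γ_{lj}^k ∂_i v^l`
(summation over `l`). -/
noncomputable def killingOp (Γ : Fin 2 → Fin 2 → Fin 2 → (Fin 2 → ℝ) → ℝ)
    (v : Fin 2 → (Fin 2 → ℝ) → ℝ) (i j k : Fin 2) (p : Fin 2 → ℝ) : ℝ :=
  pd (fun q => pd (v k) j q) i p
    + (∑ l : Fin 2, v l p * pd (Γ i j k) l p)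
    - (∑ l : Fin 2, Γ i j l p * pd (v k) l p)
    + (∑ l : Fin 2, Γ i l k p * pd (v l) j p)
    + (∑ l : Fin 2, Γ l j k p * pd (v l) i p)

/-- `v` is an affine Killing vector field for the connection `Γ` on `U`:
all eight affine Killing equations hold on `U`. -/
def IsAffineKilling (U : Set (Fin 2 → ℝ))
    (Γ : Fin 2 → Fin 2 → Fin 2 → (Fin 2 → ℝ) → ℝ)
    (v : Fin 2 → (Fin 2 → ℝ) → ℝ) : Prop :=
  ∀ i j k : Fin 2, ∀ p ∈ U, killingOp Γ v i j k p = 0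

theorem HasFDerivAt.pd_eq {f : (Fin 2 → ℝ) → ℝ} {f' : (Fin 2 → ℝ) →L[ℝ] ℝ} {p : Fin 2 → ℝ}
    (h : HasFDerivAt f f' p) (i : Fin 2) : pd f i p = f' (Pi.single i 1) := by
  rw [pd, h.fderiv]

theorem contDiff_pd {f : (Fin 2 → ℝ) → ℝ} (hf : ContDiff ℝ (⊤ : ℕ∞) f) (i : Fin 2) :
    ContDiff ℝ (⊤ : ℕ∞) (pd f i) :=
  (hf.fderiv_right (m := (⊤ : ℕ∞)) (by simp)).clm_apply contDiff_const

theorem pd_pd_comm {f : (Fin 2 → ℝ) → ℝ} (hf : ContDiff ℝ (⊤ : ℕ∞) f) (i j : Fin 2)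
    (p : Fin 2 → ℝ) : pd (pd f j) i p = pd (pd f i) j p := by
  have hd : DifferentiableAt ℝ (fderiv ℝ f) p :=
    ((hf.fderiv_right (m := (⊤ : ℕ∞)) (by simp)).differentiable (by simp)) p
  have key (a b : Fin 2) : pd (pd f b) a p
      = fderiv ℝ (fderiv ℝ f) p (Pi.single a 1) (Pi.single b 1) := by
    have h := hd.hasFDerivAt.clm_apply (hasFDerivAt_const (Pi.single b (1 : ℝ)) p)
    rw [show pd f b = fun q => fderiv ℝ f q (Pi.single b 1) from rfl, h.pd_eq]
    simp
  rw [key, key]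
  exact (hf.contDiffAt.isSymmSndFDerivAt (by simpa using WithTop.coe_le_coe.2 (le_top : (2 : ℕ∞) ≤ ⊤))) _ _

theorem eq_const_of_pd_eq_zero {f : (Fin 2 → ℝ) → ℝ} (hf : Differentiable ℝ f)
    (h : ∀ i p, pd f i p = 0) : ∃ c, ∀ p, f p = c := by
  refine ⟨f 0, fun p => is_const_of_fderiv_eq_zero hf (fun q => ?_) p 0⟩
  refine ContinuousLinearMap.coe_injective (LinearMap.pi_ext' fun i => LinearMap.ext_ring ?_)
  simpa [pd] using h i q

theorem pd_const (c : ℝ) (i : Fin 2) (p : Fin 2 → ℝ) : pd (fun _ => c) i p = 0 := by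
  simp [pd]

theorem pd_coord (j i : Fin 2) (p : Fin 2 → ℝ) :
    pd (fun q => q j) i p = (Pi.single i 1 : Fin 2 → ℝ) j :=
  (hasFDerivAt_apply j p).pd_eq i

theorem pd_add {f g : (Fin 2 → ℝ) → ℝ} (hf : Differentiable ℝ f) (hg : Differentiable ℝ g)
    (i : Fin 2) (p : Fin 2 → ℝ) : pd (fun q => f q + g q) i p = pd f i p + pd g i p :=
  ((hf p).hasFDerivAt.add (hg p).hasFDerivAt).pd_eq i

theorem pd_mul {f g : (Fin 2 → ℝ) → ℝ} (hf : Differentiable ℝ f) (hg : Differentiable ℝ g)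
    (i : Fin 2) (p : Fin 2 → ℝ) :
    pd (fun q => f q * g q) i p = f p * pd g i p + g p * pd f i p :=
  ((hf p).hasFDerivAt.mul (hg p).hasFDerivAt).pd_eq i

theorem pd_exp {f : (Fin 2 → ℝ) → ℝ} (hf : Differentiable ℝ f) (i : Fin 2) (p : Fin 2 → ℝ) :
    pd (fun q => Real.exp (f q)) i p = Real.exp (f p) * pd f i p :=
  (hf p).hasFDerivAt.exp.pd_eq i

theorem pd_neg (f : (Fin 2 → ℝ) → ℝ) (i : Fin 2) (p : Fin 2 → ℝ) :
    pd (fun q => -f q) i p = -pd f i p := by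
  simp [pd]

theorem pd_affine_add_exp (b c d : ℝ) (i : Fin 2) :
    pd (fun p => b + c * p 1 + d * Real.exp (-p 0)) i
      = fun p => ![-(d * Real.exp (-p 0)), c] i := by
  funext p
  rw [pd_add (by fun_prop) (by fun_prop), pd_add (by fun_prop) (by fun_prop),
    pd_mul (by fun_prop) (by fun_prop), pd_mul (by fun_prop) (by fun_prop),
    pd_exp (by fun_prop), pd_neg, pd_coord, pd_coord]
  simp only [pd_const]
  fin_cases i <;> simp

/-- A smooth `f` with `f₁₁ + f₁ = f₁₂ = f₂₂ = 0` is of the form `b + c x² + d e^{-x¹}`. -/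
theorem eq_affine_add_exp_of_pd {f : (Fin 2 → ℝ) → ℝ} (hf : ContDiff ℝ (⊤ : ℕ∞) f)
    (h00 : ∀ p, pd (pd f 0) 0 p + pd f 0 p = 0) (h01 : ∀ p, pd (pd f 1) 0 p = 0)
    (h11 : ∀ p, pd (pd f 1) 1 p = 0) :
    ∃ b c d : ℝ, ∀ p, f p = b + c * p 1 + d * Real.exp (-p 0) := by
  have hf' : Differentiable ℝ f := hf.differentiable (by simp)
  have hd (i : Fin 2) : Differentiable ℝ (pd f i) := (contDiff_pd hf i).differentiable (by simp)
  obtain ⟨c, hc⟩ := eq_const_of_pd_eq_zero (hd 1) (Fin.forall_fin_two.2 ⟨h01, h11⟩)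
  have hd0 := hd 0
  obtain ⟨d, hd'⟩ := eq_const_of_pd_eq_zero (f := fun p => pd f 0 p * Real.exp (p 0))
    (by fun_prop) (by
      intro i p
      rw [pd_mul hd0 (by fun_prop), pd_exp (by fun_prop), pd_coord]
      fin_cases i
      · simp only [Fin.zero_eta, Pi.single_eq_same]
        linear_combination Real.exp (p 0) * h00 p
      · simp [pd_pd_comm hf 1 0 p, h01 p])
  obtain ⟨b, hb⟩ := eq_const_of_pd_eq_zero
    (f := fun p => f p + (0 + (-c) * p 1 + d * Real.exp (-p 0)))
    (by fun_prop) (by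
      intro i p
      rw [pd_add hf' (by fun_prop), pd_affine_add_exp]
      fin_cases i
      · simp [← hd' p, mul_assoc, ← Real.exp_add]
      · simp [hc p])
  exact ⟨b, c, -d, fun p => by linear_combination hb p⟩

theorem stmt4 (T2 : ℝ) (hT : T2 ≠ 0)
    (v : Fin 2 → (Fin 2 → ℝ) → ℝ)
    (hv : ∀ i : Fin 2, ContDiff ℝ (⊤ : ℕ∞) (v i)) :
    IsAffineKilling Set.univ
      (fun i j k => fun _ : Fin 2 → ℝ =>
        ![![![(1 : ℝ), 0], ![0, 1 + T2]], ![![0, 1 - T2], ![0, 0]]] i j k) v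
    ↔ ∃ a b c d : ℝ, ∀ p : Fin 2 → ℝ,
        v 0 p = a
        ∧ v 1 p = b + c * p 1 + d * Real.exp (-p 0) := by
  constructor
  · intro h
    have K (i j k : Fin 2) (p : Fin 2 → ℝ) := h i j k p (Set.mem_univ p)
    simp only [killingOp, pd_const, Fin.sum_univ_two] at K
    have hu1 (p : Fin 2 → ℝ) : pd (v 0) 1 p = 0 := by
      have e1 := K 0 1 0 p
      have e2 := K 1 0 0 p
      have e3 := pd_pd_comm (hv 0) 0 1 p
      simp at e1 e2
      refine (mul_eq_zero.1 (?_ : T2 * pd (v 0) 1 p = 0)).resolve_left hT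
      linear_combination (e2 - e1 + e3) / 2
    have hu0 (p : Fin 2 → ℝ) : pd (v 0) 0 p = 0 := by
      have e1 := K 0 1 1 p
      have e2 := K 1 0 1 p
      have e3 := pd_pd_comm (hv 1) 0 1 p
      simp at e1 e2
      refine (mul_eq_zero.1 (?_ : T2 * pd (v 0) 0 p = 0)).resolve_left hT
      linear_combination (e1 - e2 - e3) / 2
    obtain ⟨a, ha⟩ := eq_const_of_pd_eq_zero ((hv 0).differentiable (by simp))
      (Fin.forall_fin_two.2 ⟨hu0, hu1⟩)
    obtain ⟨b, c, d, hw⟩ := eq_affine_add_exp_of_pd (hv 1)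
      (fun p => by
        have e := K 0 0 1 p
        simp at e
        linear_combination e)
      (fun p => by
        have e := K 0 1 1 p
        simp [hu0 p] at e
        linear_combination e)
      (fun p => by
        have e := K 1 1 1 p
        simp [hu1 p] at e
        linear_combination e)
    exact ⟨a, b, c, d, fun p => ⟨ha p, hw p⟩⟩
  · rintro ⟨a, b, c, d, h⟩ i j k p -
    have h0 : v 0 = fun _ => a := funext fun p => (h p).1
    have h1 : v 1 = fun p => b + c * p 1 + d * Real.exp (-p 0) := funext fun p => (h p).2
    have hp0 (i : Fin 2) : pd (v 0) i = fun _ => 0 := by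
      funext p
      rw [h0, pd_const]
    have hp1 (i : Fin 2) : pd (v 1) i = fun p => ![-(d * Real.exp (-p 0)), c] i := by
      rw [h1, pd_affine_add_exp]
    have hexp (i : Fin 2) (p : Fin 2 → ℝ) : pd (fun q => -(d * Real.exp (-q 0))) i p
        = ![d * Real.exp (-p 0), 0] i := by
      have e := congrFun (pd_affine_add_exp 0 0 (-d) i) p
      simp only [zero_add, zero_mul, neg_mul, neg_neg] at e
      exact e
    simp only [killingOp, pd_const, Fin.sum_univ_two]
    fin_cases i <;> fin_cases j <;> fin_cases k <;>
      simp [hp0, hp1, pd_const, hexp]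
    ring
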